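/- The (7,4) secure decentralized pliable index coding problem with circular side information is not linearly feasible: for every length ℓ and every decentralized linear code G of length ℓ for parameters (m = 7, s = 4), G is not simultaneously correct and secure. -/

import Mathlib

namespace SDPicod

/-- Side information set of user `i`: the `s` cyclically consecutive message
indices ending at `i`, i.e. `{i - k : k ∈ Finset.range s}`. -/
def sideInfo (m s : ℕ) (i : ZMod m) : Set (ZMod m) :=
  {j | ∃ k ∈ Finset.range s, j = i - (k : ZMod m)}

/-- A decentralized linear code: every row is encodable by some user, i.e.
its support is contained in that user's side information set. -/
def IsDecentralizedCode (m s : ℕ) {ℓ : ℕ} (G : Fin ℓ → ZMod m → ZMod 2) : Prop :=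
  ∀ t : Fin ℓ, ∃ i : ZMod m, Function.support (G t) ⊆ sideInfo m s i

/-- The set of message indices user `i` can decode: indices `j` outside the
side information set such that the standard basis vector `e j` lies in the
`GF(2)`-span of the rows of `G` together with the basis vectors of the
side information set. -/
def decSet (m s : ℕ) {ℓ : ℕ} (G : Fin ℓ → ZMod m → ZMod 2) (i : ZMod m) :
    Set (ZMod m) :=
  {j | j ∉ sideInfo m s i ∧
    Pi.single j (1 : ZMod 2) ∈ Submodule.span (ZMod 2)
      (Set.range G ∪ {v | ∃ k ∈ sideInfo m s i, v = Pi.single k (1 : ZMod 2)})}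

/-- Correctness: every user can decode at least one new message. -/
def Correct (m s : ℕ) {ℓ : ℕ} (G : Fin ℓ → ZMod m → ZMod 2) : Prop :=
  ∀ i : ZMod m, (decSet m s G i).Nonempty

/-- Security: no user can decode more than one new message. -/
def Secure (m s : ℕ) {ℓ : ℕ} (G : Fin ℓ → ZMod m → ZMod 2) : Prop :=
  ∀ i : ZMod m, (decSet m s G i).Subsingleton

end SDPicod

open SDPicod

namespace SDPicod

/-- Membership in the side information sets for `m = 7`, `s = 4`. -/
theorem notMem_sideInfo_seven_four (i j : ZMod 7) :
    j ∉ sideInfo 7 4 i ↔ j = i + 1 ∨ j = i + 2 ∨ j = i + 3 := by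
  simp only [sideInfo, Set.mem_ofPred_eq]
  revert i j
  decide

section Decoding

variable {m s ℓ : ℕ} {G : Fin ℓ → ZMod m → ZMod 2} {i j : ZMod m}

/-- A linear functional that vanishes on the code and on the side information of a user
vanishes on every message this user decodes. -/
theorem map_single_eq_zero_of_mem_decSet (hj : j ∈ decSet m s G i)
    (φ : (ZMod m → ZMod 2) →ₗ[ZMod 2] ZMod 2) (hG : ∀ t, φ (G t) = 0)
    (hA : ∀ k ∈ sideInfo m s i, φ (Pi.single k 1) = 0) : φ (Pi.single j 1) = 0 := by
  have h : Submodule.span (ZMod 2) (Set.range G ∪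
      {v | ∃ k ∈ sideInfo m s i, v = Pi.single k (1 : ZMod 2)}) ≤ LinearMap.ker φ := by
    rw [Submodule.span_le]
    rintro v (⟨t, rfl⟩ | ⟨k, hk, rfl⟩)
    · exact hG t
    · exact hA k hk
  exact h hj.2

theorem column_ne_zero_of_mem_decSet (hj : j ∈ decSet m s G i) : (fun t => G t j) ≠ 0 := by
  intro h
  have := map_single_eq_zero_of_mem_decSet hj (LinearMap.proj j) (fun t => congrFun h t)
    fun k hk => by
      have hjk : j ≠ k := fun e => hj.1 (e ▸ hk)
      simp [hjk]
  simp at this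

theorem column_ne_column_of_mem_decSet (hj : j ∈ decSet m s G i) {k : ZMod m}
    (hk : k ∉ sideInfo m s i) (hjk : j ≠ k) : (fun t => G t j) ≠ fun t => G t k := by
  intro h
  have := map_single_eq_zero_of_mem_decSet hj
    ((LinearMap.proj j : (ZMod m → ZMod 2) →ₗ[ZMod 2] ZMod 2) - LinearMap.proj k)
    (fun t => by simpa [sub_eq_zero] using congrFun h t)
    fun a ha => by
      have hja : j ≠ a := fun e => hj.1 (e ▸ ha)
      have hka : k ≠ a := fun e => hk (e ▸ ha)
      simp [hja, hka]
  simp [hjk.symm] at this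

/-- A user decodes message `k` from a row involving `k` whose other unknown messages are
already decoded. -/
theorem mem_decSet_of_row [NeZero m] {k : ZMod m} (hk : k ∉ sideInfo m s i) (t : Fin ℓ)
    (htk : G t k = 1)
    (ht : ∀ p, p ≠ k → p ∉ sideInfo m s i → G t p = 0 ∨ p ∈ decSet m s G i) :
    k ∈ decSet m s G i := by
  refine ⟨hk, ?_⟩
  have h : (Pi.single k 1 : ZMod m → ZMod 2) =
      G t - ∑ p ∈ Finset.univ.erase k, G t p • Pi.single p 1 := by
    have hsum := Finset.add_sum_erase _ (fun p => G t p • (Pi.single p 1 : ZMod m → ZMod 2))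
      (Finset.mem_univ k)
    simp only [htk, one_smul] at hsum
    rw [eq_sub_iff_add_eq, hsum]
    ext q
    simp [Finset.sum_apply, Pi.single_apply]
  rw [h]
  refine Submodule.sub_mem _ (Submodule.subset_span (Or.inl ⟨t, rfl⟩))
    (Submodule.sum_mem _ fun p hp => ?_)
  by_cases hpA : p ∈ sideInfo m s i
  · exact Submodule.smul_mem _ _ (Submodule.subset_span (Or.inr ⟨p, hpA, rfl⟩))
  · rcases ht p (Finset.ne_of_mem_erase hp) hpA with h0 | hd
    · simp [h0]
    · exact Submodule.smul_mem _ _ hd.2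

end Decoding

variable {ℓ : ℕ} {G : Fin ℓ → ZMod 7 → ZMod 2}

/-- If user `i` decodes only `j`, the columns of its two other unknown messages agree. -/
theorem column_eq_column_of_mem_decSet {i j k l : ZMod 7} (hS : Secure 7 4 G)
    (hj : j ∈ decSet 7 4 G i) (hk : k ∉ sideInfo 7 4 i) (hl : l ∉ sideInfo 7 4 i)
    (hjk : j ≠ k) (hjl : j ≠ l)
    (hp : ∀ p, p ∉ sideInfo 7 4 i → p = j ∨ p = k ∨ p = l) :
    (fun t => G t k) = fun t => G t l := by
  have key : ∀ t, G t k = 1 → G t l = 0 → False := fun t h1 h0 =>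
    hjk (hS i hj (mem_decSet_of_row hk t h1 fun p hpk hpA => by
      rcases hp p hpA with rfl | rfl | rfl
      · exact Or.inr hj
      · exact absurd rfl hpk
      · exact Or.inl h0))
  have key₂ : ∀ t, G t l = 1 → G t k = 0 → False := fun t h1 h0 =>
    hjl (hS i hj (mem_decSet_of_row hl t h1 fun p hpl hpA => by
      rcases hp p hpA with rfl | rfl | rfl
      · exact Or.inr hj
      · exact Or.inl h0
      · exact absurd rfl hpl))
  funext t
  have h01 : ∀ a : ZMod 2, a = 0 ∨ a = 1 := by decide
  rcases h01 (G t k) with h | h <;> rcases h01 (G t l) with hl0 | hl0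
  · rw [h, hl0]
  · exact (key₂ t hl0 h).elim
  · exact (key t h hl0).elim
  · rw [h, hl0]

/-- Among three elements, exactly two agree, and the third one differs from `z`. -/
def OddOneOut {α : Type*} (z a b c : α) : Prop :=
  (b = c ∧ a ≠ b ∧ a ≠ z) ∨ (a = c ∧ b ≠ a ∧ b ≠ z) ∨ (a = b ∧ c ≠ a ∧ c ≠ z)

theorem oddOneOut_columns (hC : Correct 7 4 G) (hS : Secure 7 4 G) (i : ZMod 7) :
    OddOneOut 0 (fun t => G t (i + 1)) (fun t => G t (i + 2)) (fun t => G t (i + 3)) := by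
  have h1 := (notMem_sideInfo_seven_four i (i + 1)).2 (by simp)
  have h2 := (notMem_sideInfo_seven_four i (i + 2)).2 (by simp)
  have h3 := (notMem_sideInfo_seven_four i (i + 3)).2 (by simp)
  have h12 : i + 1 ≠ i + 2 := by simpa using (by decide)
  have h13 : i + 1 ≠ i + 3 := by simpa using (by decide)
  have h23 : i + 2 ≠ i + 3 := by simpa using (by decide)
  have hp := fun p => (notMem_sideInfo_seven_four i p).1
  obtain ⟨j, hj⟩ := hC i
  rcases hp j hj.1 with rfl | rfl | rfl
  · exact Or.inl ⟨column_eq_column_of_mem_decSet hS hj h2 h3 h12 h13 hp,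
      column_ne_column_of_mem_decSet hj h2 h12, column_ne_zero_of_mem_decSet hj⟩
  · refine Or.inr (Or.inl ⟨column_eq_column_of_mem_decSet hS hj h1 h3 h12.symm h23 ?_,
      column_ne_column_of_mem_decSet hj h1 h12.symm, column_ne_zero_of_mem_decSet hj⟩)
    intro p h
    have := hp p h
    tauto
  · refine Or.inr (Or.inr ⟨column_eq_column_of_mem_decSet hS hj h1 h2 h13.symm h23.symm ?_,
      column_ne_column_of_mem_decSet hj h1 h13.symm, column_ne_zero_of_mem_decSet hj⟩)
    intro p h
    have := hp p h
    tauto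

/-- A nonzero column of a decentralized code differs from three consecutive columns. -/
theorem exists_window_column_ne (hG : IsDecentralizedCode 7 4 G) {j : ZMod 7}
    (hj : (fun t => G t j) ≠ 0) :
    ∃ i : ZMod 7, ∀ k : ZMod 7, k = i + 1 ∨ k = i + 2 ∨ k = i + 3 →
      (fun t => G t k) ≠ fun t => G t j := by
  obtain ⟨t, ht⟩ := Function.ne_iff.1 hj
  obtain ⟨i, hi⟩ := hG t
  refine ⟨i, fun k hk h => ?_⟩
  have hk0 : G t k = 0 := by
    by_contra h0
    exact (notMem_sideInfo_seven_four i k).2 hk (hi h0)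
  exact ht ((congrFun h t).symm.trans hk0)

section CyclicWord

variable {α : Type*} {z : α} {f : ZMod 7 → α}

theorem OddOneOut.shift (hf : ∀ i, OddOneOut z (f (i + 1)) (f (i + 2)) (f (i + 3)))
    (c : ZMod 7) : OddOneOut z (f (c + 1)) (f (c + 2)) (f (c + 3)) ∧
      OddOneOut z (f (c + 2)) (f (c + 3)) (f (c + 4)) ∧
      OddOneOut z (f (c + 3)) (f (c + 4)) (f (c + 5)) ∧
      OddOneOut z (f (c + 4)) (f (c + 5)) (f (c + 6)) ∧
      OddOneOut z (f (c + 5)) (f (c + 6)) (f c) ∧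
      OddOneOut z (f (c + 6)) (f c) (f (c + 1)) ∧
      OddOneOut z (f c) (f (c + 1)) (f (c + 2)) := by
  have h (a b₁ b₂ b₃ : ZMod 7) (h₁ : a + 1 = b₁) (h₂ : a + 2 = b₂) (h₃ : a + 3 = b₃) :
      OddOneOut z (f (c + b₁)) (f (c + b₂)) (f (c + b₃)) := by
    simpa only [add_assoc, h₁, h₂, h₃] using hf (c + a)
  have h0 : c + 0 = c := add_zero c
  refine ⟨hf c, h 1 _ _ _ rfl rfl rfl, h 2 _ _ _ rfl rfl rfl, h 3 _ _ _ rfl rfl rfl, ?_, ?_, ?_⟩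
  · simpa only [h0] using h 4 5 6 0 rfl rfl rfl
  · simpa only [h0] using h 5 6 0 1 rfl rfl rfl
  · simpa only [h0] using h 6 0 1 2 rfl rfl rfl

theorem OddOneOut.ne_of_cyclic
    (hf : ∀ i, OddOneOut z (f (i + 1)) (f (i + 2)) (f (i + 3))) (c : ZMod 7) : f c ≠ z := by
  obtain ⟨h0, h1, h2, h3, h4, h5, h6⟩ := OddOneOut.shift hf c
  unfold OddOneOut at *
  generalize f c = x0, f (c + 1) = x1, f (c + 2) = x2, f (c + 3) = x3, f (c + 4) = x4,
    f (c + 5) = x5, f (c + 6) = x6 at *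
  rintro rfl
  grind

/-- There is no cyclic word of length `7` in which every three consecutive letters have an
odd one out distinct from `z`, and every letter other than `z` avoids three consecutive
positions. -/
theorem no_cyclic_word
    (hf : ∀ i, OddOneOut z (f (i + 1)) (f (i + 2)) (f (i + 3)))
    (hw : ∀ j, f j ≠ z → ∃ i : ZMod 7, ∀ k, k = i + 1 ∨ k = i + 2 ∨ k = i + 3 → f k ≠ f j) :
    False := by
  have h_avoid (j a b : ZMod 7) (ha : f a = f j) (hb : f b = f j)
      (h : ∀ i, ∃ k, (k = j ∨ k = a ∨ k = b) ∧ (k = i + 1 ∨ k = i + 2 ∨ k = i + 3)) : False := by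
    obtain ⟨i, hi⟩ := hw j (OddOneOut.ne_of_cyclic hf j)
    obtain ⟨k, rfl | rfl | rfl, hk⟩ := h i
    exacts [hi _ hk rfl, hi _ hk ha, hi _ hk hb]
  have h331 (c : ZMod 7) : ¬ (f (c + 3) = f c ∧ f (c + 6) = f c) := fun h =>
    h_avoid c _ _ h.1 h.2 (by clear h; revert c; decide)
  have h322 (c : ZMod 7) : ¬ (f (c + 3) = f c ∧ f (c + 5) = f c) := fun h =>
    h_avoid c _ _ h.1 h.2 (by clear h; revert c; decide)
  obtain ⟨c, hc⟩ : ∃ c, f c = f (c + 2) := by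
    by_contra! h
    have h0 : f 0 ≠ f 2 := h 0
    have h1 : f 1 ≠ f 3 := h 1
    have h2 : f 2 ≠ f 4 := h 2
    have h3 : f 3 ≠ f 5 := h 3
    have h4 : f 4 ≠ f 6 := h 4
    have h5 : f 5 ≠ f 0 := h 5
    have h6 : f 6 ≠ f 1 := h 6
    obtain ⟨a0, a1, a2, a3, a4, a5, a6⟩ := OddOneOut.shift hf 0
    simp only [zero_add] at a0 a1 a2 a3 a4 a5 a6
    clear h h331 h322 h_avoid hf hw
    unfold OddOneOut at *
    grind
  have s331 (a b d : ZMod 7) (hb : a + 3 = b) (hd : a + 6 = d) :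
      ¬ (f (c + b) = f (c + a) ∧ f (c + d) = f (c + a)) := by
    simpa only [add_assoc, hb, hd] using h331 (c + a)
  have s322 (a b d : ZMod 7) (hb : a + 3 = b) (hd : a + 5 = d) :
      ¬ (f (c + b) = f (c + a) ∧ f (c + d) = f (c + a)) := by
    simpa only [add_assoc, hb, hd] using h322 (c + a)
  have h362 := s331 3 6 2 rfl rfl
  have h250 := s322 2 5 0 rfl rfl
  have h361 := s322 3 6 1 rfl rfl
  have h402 := s322 4 0 2 rfl rfl
  obtain ⟨a0, a1, a2, a3, a4, a5, a6⟩ := OddOneOut.shift hf c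
  simp only [add_zero] at *
  clear s331 s322 h331 h322 h_avoid hf hw
  unfold OddOneOut at *
  generalize f c = x0, f (c + 1) = x1, f (c + 2) = x2, f (c + 3) = x3, f (c + 4) = x4,
    f (c + 5) = x5, f (c + 6) = x6 at *
  grind

end CyclicWord

end SDPicod

theorem infeasible_m7_s4 (ℓ : ℕ) (G : Fin ℓ → ZMod 7 → ZMod 2)
    (hG : IsDecentralizedCode 7 4 G) :
    ¬ (Correct 7 4 G ∧ Secure 7 4 G) := by
  rintro ⟨hC, hS⟩
  exact no_cyclic_word (f := fun j t => G t j) (oddOneOut_columns hC hS)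
    fun _ hj => exists_window_column_ne hG hj
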